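/- Let θ be an irrational number, d a nonzero integer, and η a real number, and let f : 𝕋 → ℝ be the constant function equal to η. Then every continuous map ψ : T² → T² satisfying ψ ∘ φ_{θ,d,η} = φ_{θ,d,0} ∘ ψ is of the form ψ(x, y) = (x·e^{2πi(mθ + η + k)/d}, x^m·y·e^{2πi c}) for some integers m, k and some real constant c; in particular every such ψ is a smooth diffeomorphism of T² preserving the Haar measure of T². -/

import Mathlib

open MeasureTheory
open scoped Manifold

noncomputable instance : MeasurableSpace Circle := borel Circle
instance : BorelSpace Circle := ⟨rfl⟩

/-- The Furstenberg transformation `φ_{θ,d,f}` of the two-torus `𝕋 × 𝕋`: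
`(x, y) ↦ (x·e^{2πiθ}, x^d·y·e^{2πi f(x)})`. -/
noncomputable def furstenberg (θ : ℝ) (d : ℤ) (f : Circle → ℝ) :
    Circle × Circle → Circle × Circle :=
  fun p => (p.1 * Circle.exp (2 * Real.pi * θ),
    p.1 ^ d * p.2 * Circle.exp (2 * Real.pi * f p.1))

open AddCircle

section FourierOnUnitAddCircle

theorem fourier_apply_add (n : ℤ) (s t : UnitAddCircle) :
    fourier n (s + t) = fourier n s * fourier n t := by
  simp [fourier_apply, smul_add, toCircle_add]

theorem fourier_neg_mul_self (n : ℤ) (s : UnitAddCircle) : fourier (-n) s * fourier n s = 1 := by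
  rw [← fourier_add, neg_add_cancel, fourier_zero]

theorem fourierCoeff_comp_add_right (f : UnitAddCircle → ℂ) (a : UnitAddCircle) (n : ℤ) :
    fourierCoeff (fun t => f (t + a)) n = fourier n a * fourierCoeff f n := by
  have h : ∀ t, fourier (-n) t • f (t + a) =
      fourier n a * (fun u => fourier (-n) u • f u) (t + a) := by
    intro t
    simp only [smul_eq_mul, fourier_apply_add]
    linear_combination (-(fourier (-n) t * f (t + a))) * fourier_neg_mul_self n a
  rw [fourierCoeff, fourierCoeff]
  simp_rw [h]
  rw [integral_const_mul, integral_add_right_eq_self (fun u => fourier (-n) u • f u) a]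

theorem fourierCoeff_fourier_mul (f : UnitAddCircle → ℂ) (N n : ℤ) :
    fourierCoeff (fun t => fourier N t * f t) n = fourierCoeff f (n - N) := by
  rw [fourierCoeff, fourierCoeff]
  refine integral_congr_ae (.of_forall fun t => ?_)
  simp only [smul_eq_mul]
  rw [← mul_assoc, ← fourier_add, neg_sub, sub_eq_neg_add]

theorem eq_mul_fourier_of_fourierCoeff_eq_zero {f : UnitAddCircle → ℂ} (hf : Continuous f) {m : ℤ}
    (h : ∀ n ≠ m, fourierCoeff f n = 0) (t : UnitAddCircle) :
    f t = fourierCoeff f m * fourier m t := by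
  have hs : Summable (fourierCoeff (⟨f, hf⟩ : C(UnitAddCircle, ℂ))) :=
    summable_of_ne_finset_zero (s := {m}) fun n hn => h n (by simpa using hn)
  have h1 := has_pointwise_sum_fourier_series_of_summable hs t
  have h2 := hasSum_single (f := fun i => fourierCoeff f i • fourier i t) m
    fun n hn => by simp [h n hn]
  exact h1.unique h2

theorem summable_sq_norm_fourierCoeff {f : UnitAddCircle → ℂ} (hf : Continuous f) :
    Summable fun n => ‖fourierCoeff f n‖ ^ 2 := by
  have h := (hasSum_sq_fourierCoeff
    (ContinuousMap.toLp (E := ℂ) 2 haarAddCircle ℂ (⟨f, hf⟩ : C(UnitAddCircle, ℂ)))).summable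
  simp_rw [fourierCoeff_toLp] at h
  exact h

/-- A continuous solution of a rotation equation twisted by a nontrivial character vanishes. -/
theorem eq_zero_of_twisted_rotation {f : UnitAddCircle → ℂ} (hf : Continuous f)
    {a : UnitAddCircle} {μ : ℂ} (hμ : ‖μ‖ = 1) {N : ℤ} (hN : N ≠ 0)
    (h : ∀ t, f (t + a) = μ * (fourier N t * f t)) (t : UnitAddCircle) : f t = 0 := by
  have hnorm : ∀ n, ‖fourierCoeff f n‖ = ‖fourierCoeff f (n - N)‖ := by
    intro n
    have h1 := fourierCoeff_comp_add_right f a n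
    rw [funext h, fourierCoeff.const_mul, fourierCoeff_fourier_mul] at h1
    have h2 := congrArg norm h1
    rw [norm_mul, norm_mul, hμ, fourier_apply, Circle.norm_coe, one_mul, one_mul] at h2
    exact h2.symm
  have hzero : ∀ n, fourierCoeff f n = 0 := by
    intro n
    have hconst : ∀ j : ℕ, ‖fourierCoeff f (n - j * N)‖ = ‖fourierCoeff f n‖ := by
      intro j
      induction j with
      | zero => simp
      | succ j ih =>
        rw [← ih, hnorm (n - j * N)]
        congr 2
        push_cast
        ring
    have hinj : Function.Injective fun j : ℕ => n - j * N := by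
      intro i j hij
      simpa [hN] using hij
    have hs := (summable_sq_norm_fourierCoeff hf).comp_injective hinj
    have hs' : Summable fun _ : ℕ => ‖fourierCoeff f n‖ ^ 2 := by
      refine hs.congr fun j => ?_
      simp [hconst]
    simpa using (summable_const_iff _).mp hs'
  rw [eq_mul_fourier_of_fourierCoeff_eq_zero hf (m := 0) fun n _ => hzero n, hzero, zero_mul]

/-- Continuous eigenfunctions of an irrational rotation are multiples of characters. -/
theorem exists_eq_mul_fourier_of_rotation {f : UnitAddCircle → ℂ} (hf : Continuous f)
    {a : UnitAddCircle} (ha : ∀ k ≠ 0, fourier k a ≠ 1) {μ : ℂ}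
    (h : ∀ t, f (t + a) = μ * f t) :
    ∃ (m : ℤ) (c : ℂ), ∀ t, f t = c * fourier m t := by
  have hcoeff : ∀ n, fourierCoeff f n ≠ 0 → fourier n a = μ := by
    intro n hn
    have h1 := fourierCoeff_comp_add_right f a n
    rw [funext h, fourierCoeff.const_mul] at h1
    exact (mul_right_cancel₀ hn h1).symm
  by_cases hall : ∀ n, fourierCoeff f n = 0
  · exact ⟨0, _, eq_mul_fourier_of_fourierCoeff_eq_zero hf fun n _ => hall n⟩
  · push Not at hall
    obtain ⟨m, hm⟩ := hall
    refine ⟨m, _, eq_mul_fourier_of_fourierCoeff_eq_zero hf fun n hnm => ?_⟩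
    by_contra hn
    refine ha (-m + n) (by omega) ?_
    rw [fourier_add, hcoeff n hn, ← hcoeff m hm, fourier_neg_mul_self]

theorem continuous_fourierCoeff_right {G : UnitAddCircle → UnitAddCircle → ℂ}
    (hG : Continuous G.uncurry) (n : ℤ) : Continuous fun s => fourierCoeff (G s) n := by
  have h := continuous_parametric_integral_of_continuous
    (μ := (haarAddCircle : Measure UnitAddCircle))
    (f := fun s t => fourier (-n) t • G s t)
    (((map_continuous (fourier (-n))).comp continuous_snd).smul hG) isCompact_univ
  simpa [fourierCoeff] using h

/-- Continuous eigenfunctions of an affine skew product over an irrational rotation are multiples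
of characters of the base. -/
theorem exists_eq_mul_fourier_of_skew {G : UnitAddCircle → UnitAddCircle → ℂ}
    (hG : Continuous G.uncurry) {a b : UnitAddCircle} (ha : ∀ k ≠ 0, fourier k a ≠ 1)
    {d : ℤ} (hd : d ≠ 0) {μ : ℂ} (hμ : ‖μ‖ = 1)
    (h : ∀ s t, G (s + a) (t + (d • s + b)) = μ * G s t) :
    ∃ (m : ℤ) (c : ℂ), ∀ s t, G s t = c * fourier m s := by
  have hH : ∀ n s, fourierCoeff (G (s + a)) n =
      (μ * fourier (-n) b) * (fourier (-(n * d)) s * fourierCoeff (G s) n) := by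
    intro n s
    have h1 := fourierCoeff_comp_add_right (G (s + a)) (d • s + b) n
    rw [funext (h s), fourierCoeff.const_mul, fourier_apply_add] at h1
    have h2 : fourier n (d • s) = fourier (n * d) s := by
      simp [fourier_apply, mul_smul]
    rw [h2] at h1
    linear_combination (-(fourier (-n) b * fourier (-(n * d)) s)) * h1
      - (fourierCoeff (G (s + a)) n * (fourier (-(n * d)) s * fourier (n * d) s))
        * fourier_neg_mul_self n b
      - fourierCoeff (G (s + a)) n * fourier_neg_mul_self (n * d) s
  have hzero : ∀ s, ∀ n ≠ 0, fourierCoeff (G s) n = 0 := fun s n hn =>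
    eq_zero_of_twisted_rotation (continuous_fourierCoeff_right hG n)
      (by rw [norm_mul, hμ, fourier_apply, Circle.norm_coe, one_mul])
      (neg_ne_zero.mpr (mul_ne_zero hn hd)) (hH n) s
  obtain ⟨m, c, hmc⟩ := exists_eq_mul_fourier_of_rotation (continuous_fourierCoeff_right hG 0) ha
    (μ := μ) fun s => by simpa using hH 0 s
  refine ⟨m, c, fun s t => ?_⟩
  have hc : Continuous (G s) := hG.comp (Continuous.prodMk_right s)
  rw [eq_mul_fourier_of_fourierCoeff_eq_zero hc (hzero s) t, hmc, fourier_zero, mul_one]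

end FourierOnUnitAddCircle

theorem Irrational.circleExp_zpow_ne_one {θ : ℝ} (hθ : Irrational θ) {k : ℤ} (hk : k ≠ 0) :
    Circle.exp (2 * Real.pi * θ) ^ k ≠ 1 := by
  rw [← Circle.exp_intCast_mul, Ne, Circle.exp_eq_one]
  rintro ⟨n, hn⟩
  refine (hθ.intCast_mul hk).ne_int n ?_
  have := Real.two_pi_pos.ne'
  apply mul_right_cancel₀ this
  linear_combination hn

theorem toCircle_surjective : Function.Surjective (toCircle : UnitAddCircle → Circle) := by
  intro x
  obtain ⟨t, ht⟩ := (homeomorphCircle (one_ne_zero (α := ℝ))).surjective x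
  exact ⟨t, by rw [← ht, homeomorphCircle_apply]⟩

/-- Continuous circle-valued eigenfunctions of `furstenberg θ d (fun _ => η)` are, up to a
constant, characters of the first coordinate. -/
theorem exists_eq_zpow_of_furstenberg_eigenfunction {θ : ℝ} (hθ : Irrational θ) {d : ℤ}
    (hd : d ≠ 0) {η : ℝ} {g : Circle × Circle → Circle} (hg : Continuous g) {w : Circle}
    (h : ∀ p, g (furstenberg θ d (fun _ => η) p) = w * g p) :
    ∃ (m : ℤ) (v : Circle), (∀ p, g p = p.1 ^ m * v) ∧ w = Circle.exp (2 * Real.pi * θ) ^ m := by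
  have hcoe : ∀ r : ℝ, toCircle (r : UnitAddCircle) = Circle.exp (2 * Real.pi * r) := fun r => by
    rw [toCircle_apply_mk, div_one]
  have hfourier : ∀ (k : ℤ) (s : UnitAddCircle), fourier k s = ((toCircle s ^ k : Circle) : ℂ) :=
    fun k s => by rw [fourier_apply, toCircle_zsmul]
  obtain ⟨m, c, hmc⟩ := exists_eq_mul_fourier_of_skew
    (G := fun s t => (g (toCircle s, toCircle t) : ℂ)) (a := (θ : UnitAddCircle))
    (b := (η : UnitAddCircle)) (d := d) (μ := w)
    (continuous_subtype_val.comp (hg.comp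
      ((continuous_toCircle.comp continuous_fst).prodMk (continuous_toCircle.comp continuous_snd))))
    (fun k hk => by
      rw [hfourier, hcoe, Ne, Circle.coe_eq_one]
      exact hθ.circleExp_zpow_ne_one hk)
    hd (Circle.norm_coe w) (fun s t => by
      have := congrArg ((↑) : Circle → ℂ) (h (toCircle s, toCircle t))
      rw [Circle.coe_mul] at this
      rw [← this, furstenberg]
      simp only [toCircle_add, toCircle_zsmul, hcoe]
      rw [← mul_assoc, mul_comm (toCircle t)])
  have hc : c = g (1, 1) := by
    have := hmc 0 0
    simpa using this.symm
  have hgp : ∀ p, g p = p.1 ^ m * g (1, 1) := by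
    rintro ⟨x, y⟩
    obtain ⟨s, rfl⟩ := toCircle_surjective x
    obtain ⟨t, rfl⟩ := toCircle_surjective y
    apply Circle.coe_injective
    rw [hmc s t, hfourier, hc, Circle.coe_mul, mul_comm]
  refine ⟨m, g (1, 1), hgp, ?_⟩
  have h1 := h (1, 1)
  rw [hgp] at h1
  simpa [furstenberg] using (mul_right_cancel h1).symm

/-- The composition of the shear `(x, y) ↦ (x, x ^ m * y)` of the two-torus with the translation
by `(u, v)`. -/
noncomputable def shearTranslation (m : ℤ) (u v : Circle) : Circle × Circle → Circle × Circle :=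
  fun p => (p.1 * u, p.1 ^ m * p.2 * v)

theorem Circle.contMDiff_zpow (m : ℤ) : ContMDiff (𝓡 1) (𝓡 1) (⊤ : ℕ∞) fun x : Circle => x ^ m := by
  have : LieGroup (𝓡 1) (⊤ : ℕ∞) Circle := .of_le le_top
  cases m with
  | ofNat n => simpa using contMDiff_pow (I := 𝓡 1) (G := Circle) n
  | negSucc n =>
    simp only [zpow_negSucc]
    exact (contMDiff_pow (I := 𝓡 1) (G := Circle) (n + 1)).inv

theorem contMDiff_shearTranslation (m : ℤ) (u v : Circle) :
    ContMDiff ((𝓡 1).prod (𝓡 1)) ((𝓡 1).prod (𝓡 1)) (⊤ : ℕ∞) (shearTranslation m u v) := by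
  have : LieGroup (𝓡 1) (⊤ : ℕ∞) Circle := .of_le le_top
  exact (contMDiff_fst.mul contMDiff_const).prodMk
    ((((Circle.contMDiff_zpow m).comp contMDiff_fst).mul contMDiff_snd).mul contMDiff_const)

/-- `shearTranslation m u v` as a smooth diffeomorphism of the two-torus. -/
noncomputable def shearTranslationDiffeomorph (m : ℤ) (u v : Circle) :
    Diffeomorph ((𝓡 1).prod (𝓡 1)) ((𝓡 1).prod (𝓡 1)) (Circle × Circle) (Circle × Circle)
      (⊤ : ℕ∞) where
  toFun := shearTranslation m u v
  invFun := shearTranslation (-m) u⁻¹ (u ^ m * v⁻¹)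
  left_inv p := by
    ext1
    · simp [shearTranslation]
    · simp only [shearTranslation, mul_zpow, zpow_neg]
      apply Circle.coe_injective
      push_cast
      field_simp
  right_inv p := by
    ext1
    · simp [shearTranslation]
    · simp only [shearTranslation, mul_zpow, zpow_neg, inv_zpow]
      apply Circle.coe_injective
      push_cast
      field_simp
  contMDiff_toFun := contMDiff_shearTranslation _ _ _
  contMDiff_invFun := contMDiff_shearTranslation _ _ _

theorem measurePreserving_shearTranslation (m : ℤ) (u v : Circle) :
    MeasurePreserving (shearTranslation m u v) Measure.haar Measure.haar := by
  let F : Circle × Circle →* Circle × Circle :=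
    { toFun := shearTranslation m 1 1
      map_one' := by simp [shearTranslation]
      map_mul' := fun p q => by
        simp only [shearTranslation, mul_one, Prod.fst_mul, Prod.snd_mul, mul_zpow, Prod.mk_mul_mk]
        rw [mul_mul_mul_comm] }
  have hF : MeasurePreserving F Measure.haar Measure.haar :=
    F.measurePreserving (contMDiff_shearTranslation m 1 1).continuous
      (shearTranslationDiffeomorph m 1 1).surjective rfl
  have h := (measurePreserving_mul_right (Measure.haar : Measure (Circle × Circle)) (u, v)).comp hF
  convert h using 1
  ext1 p
  simp [F, shearTranslation]

theorem furstenberg_constant_conjugating_maps_are_smooth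
    (θ : ℝ) (hθ : Irrational θ) (d : ℤ) (hd : d ≠ 0) (η : ℝ)
    (ψ : Circle × Circle → Circle × Circle) (hψ : Continuous ψ)
    (hconj : ψ ∘ furstenberg θ d (fun _ => η) = furstenberg θ d 0 ∘ ψ) :
    (∃ (m k : ℤ) (c : ℝ), ∀ p : Circle × Circle, ψ p =
        (p.1 * Circle.exp (2 * Real.pi * ((m * θ + η + k) / d)),
         p.1 ^ m * p.2 * Circle.exp (2 * Real.pi * c))) ∧
    (∃ Ψ : Diffeomorph ((𝓡 1).prod (𝓡 1)) ((𝓡 1).prod (𝓡 1))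
        (Circle × Circle) (Circle × Circle) (⊤ : ℕ∞), ⇑Ψ = ψ) ∧
    MeasurePreserving ψ Measure.haar Measure.haar := by
  set α := Circle.exp (2 * Real.pi * θ) with hα
  have hstep : ∀ p, (ψ (furstenberg θ d (fun _ => η) p)).1 = (ψ p).1 * α ∧
      (ψ (furstenberg θ d (fun _ => η) p)).2 = (ψ p).1 ^ d * (ψ p).2 := by
    intro p
    have := congrFun hconj p
    simp only [Function.comp_apply] at this
    rw [this]
    simp [furstenberg, hα]
  obtain ⟨m₀, u, hu, hm₀⟩ := exists_eq_zpow_of_furstenberg_eigenfunction hθ hd (η := η)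
    (g := fun p => (ψ p).1 * p.1⁻¹) (w := 1) (by fun_prop) (fun p => by
      rw [(hstep p).1]
      simp only [furstenberg, ← hα]
      apply Circle.coe_injective
      push_cast
      field_simp)
  have hm₀ : m₀ = 0 := by
    by_contra hne
    exact hθ.circleExp_zpow_ne_one hne hm₀.symm
  subst hm₀
  have hψ₁ : ∀ p, (ψ p).1 = p.1 * u := fun p => by
    rw [← one_mul u, ← zpow_zero p.1, ← hu p, mul_comm, inv_mul_cancel_right]
  obtain ⟨m, v, hv, hm⟩ := exists_eq_zpow_of_furstenberg_eigenfunction hθ hd (η := η)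
    (g := fun p => (ψ p).2 * p.2⁻¹) (w := u ^ d * (Circle.exp (2 * Real.pi * η))⁻¹)
    (by fun_prop) (fun p => by
      rw [(hstep p).2, hψ₁, mul_zpow]
      simp only [furstenberg]
      apply Circle.coe_injective
      push_cast
      field_simp)
  have hψ_eq : ψ = shearTranslation m u v := by
    funext p
    refine Prod.ext (hψ₁ p) ?_
    rw [shearTranslation, mul_right_comm, ← hv p, inv_mul_cancel_right]
  refine ⟨?_, ⟨shearTranslationDiffeomorph m u v, hψ_eq.symm⟩,
    hψ_eq ▸ measurePreserving_shearTranslation m u v⟩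
  obtain ⟨r, rfl⟩ := Circle.exp_surjective u
  obtain ⟨c, rfl⟩ := Circle.exp_surjective v
  have hπ := Real.pi_ne_zero
  have hd' : (d : ℝ) ≠ 0 := Int.cast_ne_zero.mpr hd
  rw [mul_inv_eq_iff_eq_mul, ← Circle.exp_intCast_mul, ← Circle.exp_intCast_mul, ← Circle.exp_add,
    Circle.exp_eq_exp] at hm
  obtain ⟨k, hk⟩ := hm
  refine ⟨m, k, c / (2 * Real.pi), fun p => ?_⟩
  have hr : 2 * Real.pi * ((m * θ + η + k) / d) = r := by
    field_simp
    linear_combination -hk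
  have hc : 2 * Real.pi * (c / (2 * Real.pi)) = c := by field_simp
  rw [hr, hc, hψ_eq, shearTranslation]
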